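/- arXiv:2212.06274 — 7 statements merged into one kernel-verified Lean document; each statement's English description precedes it below -/
import Mathlib

section
/- Let I ⊆ [n] and ℓ ∈ [n]. Then F(I) · (t_ℓ − m_{I,ℓ}) ⊆ F(<sum I); that is, for each q ∈ F(I), the element q·(t_ℓ − m_{I,ℓ}·1) lies in F(<sum I). -/
noncomputable section

namespace OneSidedCycleShuffles

/-- `sw n i` is the simple transposition `s_i ∈ S_n` (1-indexed: it swaps the values `i` and
`i+1` of `[n] = {1,…,n}`, realized on the carrier `Fin n` via the identification
`x ∈ [n] ↔ ⟨x-1⟩ : Fin n`); it is the junk value `1` unless `i ∈ [n-1]`. -/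
def sw (n i : ℕ) : Equiv.Perm (Fin n) :=
  if h : 1 ≤ i ∧ i < n then Equiv.swap ⟨i - 1, by omega⟩ ⟨i, h.2⟩ else 1

/-- `cyc n l j` is the cycle `cyc_{l,l+1,…,j} ∈ S_n` (sending `l,…,j-1,j` to `l+1,…,j,l`),
written as the product `s_l s_{l+1} ⋯ s_{j-1}` of simple transpositions. -/
def cyc (n l j : ℕ) : Equiv.Perm (Fin n) :=
  ((List.range' l (j - l)).map (sw n)).prod

/-- The somewhere-to-below shuffle `t_ℓ = cyc_ℓ + cyc_{ℓ,ℓ+1} + ⋯ + cyc_{ℓ,ℓ+1,…,n} ∈ k[S_n]`. -/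
def t (n : ℕ) (k : Type*) [CommRing k] (l : ℕ) : MonoidAlgebra k (Equiv.Perm (Fin n)) :=
  ∑ j ∈ Finset.Icc l n, MonoidAlgebra.of k (Equiv.Perm (Fin n)) (cyc n l j)

/-- `m_{I,ℓ}` : (the smallest element of the enclosure `{0} ∪ I ∪ {n+1}` that is `≥ ℓ`) `- ℓ`. -/
def mIdx (n : ℕ) (I : Finset ℕ) (l : ℕ) : ℕ :=
  sInf {x : ℕ | (x = 0 ∨ x ∈ I ∨ x = n + 1) ∧ l ≤ x} - l

/-- The non-shadow `I' = [n-1] \ (I ∪ (I-1))`. -/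
def nonShadow (n : ℕ) (I : Finset ℕ) : Finset ℕ :=
  Finset.Icc 1 (n - 1) \ (I ∪ I.image (fun i => i - 1))

/-- A set of integers is lacunar if it contains no two consecutive integers. -/
def Lacunar (I : Finset ℕ) : Prop := ∀ i ∈ I, i + 1 ∉ I

instance : DecidablePred Lacunar := fun I =>
  decidable_of_iff (∀ i ∈ I, i + 1 ∉ I) Iff.rfl

/-- The invariant space `F(I) = {q ∈ k[S_n] : q s_i = q for all i ∈ I'}`. -/
def F (n : ℕ) (k : Type*) [CommRing k] (I : Finset ℕ) :
    Submodule k (MonoidAlgebra k (Equiv.Perm (Fin n))) where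
  carrier := {q | ∀ i ∈ nonShadow n I, q * MonoidAlgebra.of k (Equiv.Perm (Fin n)) (sw n i) = q}
  add_mem' := by
    intro a b ha hb i hi
    rw [add_mul, ha i hi, hb i hi]
  zero_mem' := by
    intro i hi
    rw [zero_mul]
  smul_mem' := by
    intro c a ha i hi
    rw [smul_mul_assoc, ha i hi]

/-- `F(<c) = ∑_{J ⊆ [n], sum J < c} F(J)`. -/
def Flt (n : ℕ) (k : Type*) [CommRing k] (c : ℕ) :
    Submodule k (MonoidAlgebra k (Equiv.Perm (Fin n))) :=
  ∑ J ∈ (Finset.Icc 1 n).powerset.filter (fun J => J.sum id < c), F n k J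

/-- `F_i = F(Q_1) + ⋯ + F(Q_i)` for an enumeration `Q` of the lacunar subsets of `[n-1]`. -/
def Fi (n : ℕ) (k : Type*) [CommRing k] (Q : ℕ → Finset ℕ) (i : ℕ) :
    Submodule k (MonoidAlgebra k (Equiv.Perm (Fin n))) :=
  ∑ j ∈ Finset.Icc 1 i, F n k (Q j)

/-- The (1-indexed) value `w(i) ∈ [n]` of a permutation `w ∈ S_n` at `i ∈ [n]`
(junk value `0` if out of range). -/
def pval (n : ℕ) (w : Equiv.Perm (Fin n)) (i : ℕ) : ℕ :=
  if h : i - 1 < n then (w ⟨i - 1, h⟩).val + 1 else 0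

/-- The descent set `Des w = {i ∈ [n-1] : w(i) > w(i+1)}`. -/
def Des (n : ℕ) (w : Equiv.Perm (Fin n)) : Finset ℕ :=
  (Finset.Icc 1 (n - 1)).filter fun i => pval n w (i + 1) < pval n w i

/-- `G(T)` : the subgroup of `S_n` generated by the simple transpositions `s_i`, `i ∈ T`. -/
def G (n : ℕ) (T : Finset ℕ) : Subgroup (Equiv.Perm (Fin n)) :=
  Subgroup.closure ((T.image (sw n) : Finset (Equiv.Perm (Fin n))) : Set (Equiv.Perm (Fin n)))

open scoped Classical in
/-- `a_w = ∑_{σ ∈ G(Des w)} wσ ∈ k[S_n]`. -/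
def aw (n : ℕ) (k : Type*) [CommRing k] (w : Equiv.Perm (Fin n)) :
    MonoidAlgebra k (Equiv.Perm (Fin n)) :=
  ∑ σ ∈ Finset.univ.filter (fun σ => σ ∈ G n (Des n w)),
    MonoidAlgebra.of k (Equiv.Perm (Fin n)) (w * σ)

/-- The Q-index of `w` : the smallest `i ∈ [f_{n+1}]` with `Q_i' ⊆ Des w`. -/
def Qind (n : ℕ) (Q : ℕ → Finset ℕ) (w : Equiv.Perm (Fin n)) : ℕ :=
  sInf {i : ℕ | 1 ≤ i ∧ i ≤ Nat.fib (n + 1) ∧ nonShadow n (Q i) ⊆ Des n w}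

/-- The set of inversions of `u ∈ S_n` : pairs `(i,j) ∈ [n] × [n]` with `i < j`, `u(i) > u(j)`. -/
def InvSet (n : ℕ) (u : Equiv.Perm (Fin n)) : Finset (ℕ × ℕ) :=
  (Finset.Icc 1 n ×ˢ Finset.Icc 1 n).filter fun p => p.1 < p.2 ∧ pval n u p.2 < pval n u p.1

/-- The lexicographic order on `S_n` : `u < v` iff at the smallest `i ∈ [n]` where they
differ, `u(i) < v(i)`. -/
def lexLT (n : ℕ) (u v : Equiv.Perm (Fin n)) : Prop :=
  ∃ i ∈ Finset.Icc 1 n, pval n u i < pval n v i ∧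
    ∀ j ∈ Finset.Icc 1 n, j < i → pval n u j = pval n v j

/-- `Z(I) = {q ∈ k[S_n] : q s_i = q for all i ∈ I}`. -/
def Z (n : ℕ) (k : Type*) [CommRing k] (I : Finset ℕ) :
    Submodule k (MonoidAlgebra k (Equiv.Perm (Fin n))) where
  carrier := {q | ∀ i ∈ I, q * MonoidAlgebra.of k (Equiv.Perm (Fin n)) (sw n i) = q}
  add_mem' := by
    intro a b ha hb i hi
    rw [add_mul, ha i hi, hb i hi]
  zero_mem' := by
    intro i hi
    rw [zero_mul]
  smul_mem' := by
    intro c a ha i hi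
    rw [smul_mul_assoc, ha i hi]

/-- `R(x)` : right multiplication by `x`, as a `k`-module endomorphism of `k[S_n]`. -/
def Rmul (n : ℕ) (k : Type*) [CommRing k] (x : MonoidAlgebra k (Equiv.Perm (Fin n))) :
    Module.End k (MonoidAlgebra k (Equiv.Perm (Fin n))) :=
  LinearMap.mulRight k x


lemma sw_mul_self (n i : ℕ) : sw n i * sw n i = 1 := by
  unfold sw
  split_ifs <;> simp

lemma sw_mul_sw_comm {n x y : ℕ} (h : x + 2 ≤ y) : sw n x * sw n y = sw n y * sw n x := by
  unfold sw
  split_ifs with hx hy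
  · refine (Equiv.Perm.Disjoint.commute ?_).eq
    rw [Equiv.Perm.disjoint_iff_disjoint_support,
      Equiv.Perm.support_swap (by simp [Fin.ext_iff]; omega),
      Equiv.Perm.support_swap (by simp [Fin.ext_iff]; omega)]
    simp only [Finset.disjoint_left, Finset.mem_insert, Finset.mem_singleton, Fin.ext_iff]
    omega
  all_goals simp

/-- The braid relation between adjacent simple transpositions. -/
lemma sw_braid {n x : ℕ} (h1 : 1 ≤ x) (h2 : x + 1 < n) :
    sw n x * sw n (x + 1) * sw n x = sw n (x + 1) * sw n x * sw n (x + 1) := by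
  have h1' : 1 ≤ x ∧ x < n := by omega
  have h2' : 1 ≤ x + 1 ∧ x + 1 < n := by omega
  simp only [sw, dif_pos h1', dif_pos h2', Nat.add_sub_cancel]
  have key : ∀ u v w : Fin n, u ≠ v → u ≠ w → v ≠ w →
      Equiv.swap u v * Equiv.swap v w * Equiv.swap u v =
        Equiv.swap v w * Equiv.swap u v * Equiv.swap v w := by
    intro u v w huv huw hvw
    rw [Equiv.swap_mul_swap_mul_swap huv huw, Equiv.swap_comm u v, Equiv.swap_comm v w,
      Equiv.swap_mul_swap_mul_swap hvw.symm huw.symm, Equiv.swap_comm]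
  exact key _ _ _ (by simp [Fin.ext_iff]; omega) (by simp [Fin.ext_iff])
    (by simp [Fin.ext_iff])

lemma cyc_self (n l : ℕ) : cyc n l l = 1 := by
  simp [cyc]

lemma cyc_succ {n l j : ℕ} (h : l ≤ j) : cyc n l (j + 1) = cyc n l j * sw n j := by
  have e : j + 1 - l = (j - l) + 1 := by omega
  simp [cyc, e, List.range'_concat, Nat.add_sub_cancel' h]

lemma cyc_mul_cyc {n l i j : ℕ} (h1 : l ≤ i) (h2 : i ≤ j) :
    cyc n l i * cyc n i j = cyc n l j := by
  induction j, h2 using Nat.le_induction with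
  | base => simp [cyc_self]
  | succ j hj ih => rw [cyc_succ hj, cyc_succ (h1.trans hj), ← mul_assoc, ih]

lemma cyc_mul_sw_of_lt {n l j x : ℕ} (hlj : l ≤ j) (hx : x + 2 ≤ l ∨ j + 1 ≤ x) :
    cyc n l j * sw n x = sw n x * cyc n l j := by
  induction j, hlj using Nat.le_induction with
  | base => simp [cyc_self]
  | succ j hj ih =>
    have hc : sw n j * sw n x = sw n x * sw n j := by
      rcases hx with hx | hx
      · exact (sw_mul_sw_comm (by omega)).symm
      · exact sw_mul_sw_comm (by omega)
    rw [cyc_succ hj, mul_assoc, hc, ← mul_assoc, ih (by omega), mul_assoc]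

lemma cyc_mul_sw_of_mem {n l j x : ℕ} (hl : 1 ≤ l) (hjn : j ≤ n) (hx : l ≤ x) (hxj : x + 2 ≤ j) :
    cyc n l j * sw n x = sw n (x + 1) * cyc n l j := by
  induction j, hxj using Nat.le_induction with
  | base =>
    rw [cyc_succ (by omega), cyc_succ hx, mul_assoc, mul_assoc, ← mul_assoc (sw n x),
      sw_braid (by omega) (by omega), ← mul_assoc, ← mul_assoc,
      cyc_mul_sw_of_lt hx (by omega)]
    simp only [mul_assoc]
  | succ j hj ih =>
    rw [cyc_succ (by omega), mul_assoc, ← sw_mul_sw_comm hj, ← mul_assoc, ih (by omega),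
      mul_assoc]

section Invariance

variable {n : ℕ} {k : Type*} [CommRing k] {q : MonoidAlgebra k (Equiv.Perm (Fin n))}

local notation "ι" => MonoidAlgebra.of k (Equiv.Perm (Fin n))

lemma mul_of_cyc_eq_self {l j : ℕ} (hlj : l ≤ j)
    (h : ∀ x, l ≤ x → x < j → q * ι (sw n x) = q) : q * ι (cyc n l j) = q := by
  induction j, hlj using Nat.le_induction with
  | base => rw [cyc_self, map_one, mul_one]
  | succ j hj ih =>
    rw [cyc_succ hj, map_mul, ← mul_assoc, ih fun x h1 h2 => h x h1 (by omega),
      h j hj (by omega)]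

/-- Moving `s_x` leftwards past a cycle that turns it into `s_y`, under which `q` is invariant. -/
lemma mul_of_cyc_mul_of_sw {l j x y : ℕ} (hc : cyc n l j * sw n x = sw n y * cyc n l j)
    (hy : q * ι (sw n y) = q) : q * ι (cyc n l j) * ι (sw n x) = q * ι (cyc n l j) := by
  rw [mul_assoc, ← map_mul, hc, map_mul, ← mul_assoc, hy]

lemma sum_mul_of_sw_of_outside {c a b x : ℕ} (hca : c ≤ a) (hx : x + 2 ≤ c ∨ b ≤ x)
    (h : q * ι (sw n x) = q) :
    (∑ j ∈ Finset.Ico a b, q * ι (cyc n c j)) * ι (sw n x) =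
      ∑ j ∈ Finset.Ico a b, q * ι (cyc n c j) := by
  rw [Finset.sum_mul]
  refine Finset.sum_congr rfl fun j hj => ?_
  rw [Finset.mem_Ico] at hj
  exact mul_of_cyc_mul_of_sw (cyc_mul_sw_of_lt (by omega) (by omega)) h

lemma sum_mul_of_sw_of_below {c a b x : ℕ} (hc : 1 ≤ c) (hb : b ≤ n + 1) (hcx : c ≤ x)
    (hxa : x + 2 ≤ a) (h : x + 2 < b → q * ι (sw n (x + 1)) = q) :
    (∑ j ∈ Finset.Ico a b, q * ι (cyc n c j)) * ι (sw n x) =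
      ∑ j ∈ Finset.Ico a b, q * ι (cyc n c j) := by
  rw [Finset.sum_mul]
  refine Finset.sum_congr rfl fun j hj => ?_
  rw [Finset.mem_Ico] at hj
  exact mul_of_cyc_mul_of_sw (cyc_mul_sw_of_mem hc (by omega) hcx (by omega)) (h (by omega))

lemma sum_mul_of_sw_of_inside {c a b x : ℕ} (hc : 1 ≤ c) (hb : b ≤ n + 1) (hca : c ≤ a)
    (hax : a ≤ x) (hxb : x + 2 ≤ b)
    (h : ∀ y, a + 1 ≤ y → y + 2 ≤ b → q * ι (sw n y) = q) :
    (∑ j ∈ Finset.Ico a b, q * ι (cyc n c j)) * ι (sw n x) =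
      ∑ j ∈ Finset.Ico a b, q * ι (cyc n c j) := by
  have hlow : (∑ j ∈ Finset.Ico a x, q * ι (cyc n c j)) * ι (sw n x) =
      ∑ j ∈ Finset.Ico a x, q * ι (cyc n c j) := by
    rcases hax.eq_or_lt with rfl | hlt
    · simp
    · exact sum_mul_of_sw_of_outside hca (Or.inr le_rfl) (h x hlt hxb)
  have hmid : (∑ j ∈ Finset.Ico x (x + 2), q * ι (cyc n c j)) * ι (sw n x) =
      ∑ j ∈ Finset.Ico x (x + 2), q * ι (cyc n c j) := by
    have e : Finset.Ico x (x + 2) = {x, x + 1} := by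
      ext y
      simp only [Finset.mem_Ico, Finset.mem_insert, Finset.mem_singleton]
      omega
    rw [e, Finset.sum_pair (by omega), cyc_succ (hca.trans hax), add_mul, mul_assoc, mul_assoc,
      ← map_mul, ← map_mul, mul_assoc (cyc n c x), sw_mul_self, mul_one, add_comm]
  have hhigh : (∑ j ∈ Finset.Ico (x + 2) b, q * ι (cyc n c j)) * ι (sw n x) =
      ∑ j ∈ Finset.Ico (x + 2) b, q * ι (cyc n c j) :=
    sum_mul_of_sw_of_below hc hb (hca.trans hax) le_rfl fun hlt => h _ (by omega) (by omega)
  rw [← Finset.sum_Ico_consecutive _ hax (by omega : x ≤ b),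
    ← Finset.sum_Ico_consecutive _ (by omega : x ≤ x + 2) hxb, add_mul, add_mul,
    hlow, hmid, hhigh]

end Invariance

lemma mem_nonShadow {n : ℕ} {I : Finset ℕ} {x : ℕ} :
    x ∈ nonShadow n I ↔ 1 ≤ x ∧ x + 1 ≤ n ∧ x ∉ I ∧ x + 1 ∉ I := by
  simp only [nonShadow, Finset.mem_sdiff, Finset.mem_Icc, Finset.mem_union, Finset.mem_image,
    not_or, not_exists, not_and]
  constructor
  · rintro ⟨⟨h1, h2⟩, h3, h4⟩
    exact ⟨h1, by omega, h3, fun h => h4 _ h rfl⟩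
  · rintro ⟨h1, h2, h3, h4⟩
    refine ⟨⟨h1, by omega⟩, h3, fun y hy e => h4 ?_⟩
    rwa [← e, Nat.sub_add_cancel (by omega)]

/-- The set obtained from `I` by lowering its elements in `[i, b)` by `1` and discarding `0`. -/
def shiftDown (I : Finset ℕ) (i b : ℕ) : Finset ℕ :=
  (I.image fun y => if i ≤ y ∧ y < b then y - 1 else y).erase 0

lemma mem_shiftDown_of_outside {I : Finset ℕ} {i b y : ℕ} (hy : y ∈ I) (h0 : 1 ≤ y)
    (h : y < i ∨ b ≤ y) : y ∈ shiftDown I i b :=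
  Finset.mem_erase.2 ⟨by omega, Finset.mem_image.2 ⟨y, hy, if_neg (by omega)⟩⟩

lemma mem_shiftDown_of_succ_mem {I : Finset ℕ} {i b y : ℕ} (hy : y + 1 ∈ I) (h0 : 1 ≤ y)
    (h1 : i ≤ y + 1) (h2 : y + 1 < b) : y ∈ shiftDown I i b :=
  Finset.mem_erase.2 ⟨by omega, Finset.mem_image.2 ⟨y + 1, hy, if_pos ⟨h1, h2⟩⟩⟩

lemma shiftDown_subset {n : ℕ} {I : Finset ℕ} (hI : I ⊆ Finset.Icc 1 n) (i b : ℕ) :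
    shiftDown I i b ⊆ Finset.Icc 1 n := by
  intro x hx
  obtain ⟨h0, hx⟩ := Finset.mem_erase.1 hx
  obtain ⟨y, hy, rfl⟩ := Finset.mem_image.1 hx
  have := Finset.mem_Icc.1 (hI hy)
  rw [Finset.mem_Icc]
  split_ifs at h0 ⊢ <;> omega

lemma sum_shiftDown_lt {n : ℕ} {I : Finset ℕ} (hI : I ⊆ Finset.Icc 1 n) {i b : ℕ} (hi : i ∈ I)
    (hib : i < b) : (shiftDown I i b).sum id < I.sum id := by
  have hi1 := Finset.mem_Icc.1 (hI hi)
  calc (shiftDown I i b).sum id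
      ≤ (I.image fun y => if i ≤ y ∧ y < b then y - 1 else y).sum id :=
        Finset.sum_le_sum_of_subset (Finset.erase_subset _ _)
    _ ≤ ∑ y ∈ I, if i ≤ y ∧ y < b then y - 1 else y :=
        Finset.sum_image_le_of_nonneg fun _ _ => Nat.zero_le _
    _ < I.sum id := by
        refine Finset.sum_lt_sum (fun y _ => ?_) ⟨i, hi, ?_⟩
        · simp only [id]
          split_ifs <;> omega
        · simp only [id, le_refl, hib, and_self, if_true]
          omega

lemma F_le_Flt {n : ℕ} {k : Type*} [CommRing k] {J : Finset ℕ} {c : ℕ}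
    (hJ : J ⊆ Finset.Icc 1 n) (hc : J.sum id < c) : F n k J ≤ Flt n k c :=
  Finset.single_le_sum_of_canonicallyOrdered (f := F n k)
    (Finset.mem_filter.2 ⟨Finset.mem_powerset.2 hJ, hc⟩)

section Blocks

variable {n : ℕ} {k : Type*} [CommRing k] {q : MonoidAlgebra k (Equiv.Perm (Fin n))}
  {I : Finset ℕ}

local notation "ι" => MonoidAlgebra.of k (Equiv.Perm (Fin n))

/-- A block sum over `[a, b)`, for consecutive elements `a < b` of `I ∪ {n + 1}`, is invariant
under the non-shadow of the set obtained by lowering the elements of `I` in `[i, a]`. -/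
lemma sum_block_mem_F (hI : I ⊆ Finset.Icc 1 n) (hq : q ∈ F n k I) {c i a b : ℕ}
    (hc : 1 ≤ c) (hci : c = i ∨ c + 1 = i) (hi : i ∈ I) (ha : a ∈ I) (hia : i ≤ a) (hab : a < b)
    (hb : b ∈ I ∨ b = n + 1) (hgap : ∀ y ∈ I, a < y → b ≤ y) :
    ∑ j ∈ Finset.Ico a b, q * ι (cyc n c j) ∈ F n k (shiftDown I i b) := by
  have hq' : ∀ y, 1 ≤ y → y + 1 ≤ n → y ∉ I → y + 1 ∉ I → q * ι (sw n y) = q :=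
    fun y h1 h2 h3 h4 => hq y (mem_nonShadow.2 ⟨h1, h2, h3, h4⟩)
  have han := Finset.mem_Icc.1 (hI ha)
  have hbn : b ≤ n + 1 := by
    rcases hb with hb | hb
    · have := Finset.mem_Icc.1 (hI hb)
      omega
    · exact hb.le
  intro x hx
  obtain ⟨hx1, hxn, hxJ, hxJ'⟩ := mem_nonShadow.1 hx
  have hout : ∀ y ∈ I, y = x ∨ y = x + 1 → i ≤ y ∧ y < b := by
    intro y hy hyx
    by_contra hcon
    have := mem_shiftDown_of_outside (i := i) (b := b) hy (by omega) (by omega)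
    rcases hyx with rfl | rfl
    exacts [hxJ this, hxJ' this]
  have hin : ∀ y ∈ I, y = x + 1 ∨ y = x + 2 → ¬ (i ≤ y ∧ y < b) := by
    rintro y hy (rfl | rfl) ⟨h1, h2⟩
    · exact hxJ (mem_shiftDown_of_succ_mem hy hx1 h1 h2)
    · exact hxJ' (mem_shiftDown_of_succ_mem hy (by omega) h1 h2)
  have hxc : x + 1 ≠ c := fun h => hin i hi (by omega) (by omega)
  have hxa : x + 1 ≠ a := fun h => hin a ha (by omega) (by omega)
  have hxb : x + 1 ≠ b := by
    rintro rfl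
    rcases hb with hb | hb
    · have := hout _ hb (Or.inr rfl)
      omega
    · omega
  rcases (by omega : (x + 2 ≤ c ∨ b ≤ x) ∨ (c ≤ x ∧ x + 2 ≤ a) ∨ (a ≤ x ∧ x + 2 ≤ b)) with
    h | ⟨h1, h2⟩ | ⟨h1, h2⟩
  · refine sum_mul_of_sw_of_outside (by omega) h (hq' x hx1 hxn (fun hy => ?_) fun hy => ?_)
    · have := hout _ hy (Or.inl rfl)
      omega
    · have := hout _ hy (Or.inr rfl)
      omega
  · refine sum_mul_of_sw_of_below hc hbn h1 h2 fun _ =>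
      hq' (x + 1) (by omega) (by omega) (fun hy => ?_) fun hy => ?_
    · exact hin _ hy (Or.inl rfl) (by omega)
    · exact hin _ hy (Or.inr rfl) (by omega)
  · refine sum_mul_of_sw_of_inside hc hbn (by omega) h1 h2 fun y h3 h4 =>
      hq' y (by omega) (by omega) (fun hy => ?_) fun hy => ?_
    · have := hgap _ hy (by omega)
      omega
    · have := hgap _ hy (by omega)
      omega

lemma sum_Ico_mem_Flt (hI : I ⊆ Finset.Icc 1 n) (hq : q ∈ F n k I) {c i : ℕ}
    (hc : 1 ≤ c) (hci : c = i ∨ c + 1 = i) (hi : i ∈ I) (b : ℕ) (hib : i ≤ b)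
    (hb : b ∈ I ∨ b = n + 1) :
    ∑ j ∈ Finset.Ico i b, q * ι (cyc n c j) ∈ Flt n k (I.sum id) := by
  induction b using Nat.strong_induction_on with
  | _ b ih =>
    rcases hib.eq_or_lt with rfl | hlt
    · simp
    have hne : (I.filter (· < b)).Nonempty := ⟨i, Finset.mem_filter.2 ⟨hi, hlt⟩⟩
    obtain ⟨a, ha, hmax⟩ := Finset.exists_max_image _ id hne
    obtain ⟨haI, hab⟩ := Finset.mem_filter.1 ha
    have hia : i ≤ a := hmax i (Finset.mem_filter.2 ⟨hi, hlt⟩)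
    rw [← Finset.sum_Ico_consecutive _ hia hab.le]
    refine add_mem (ih a hab hia (Or.inl haI)) (F_le_Flt (shiftDown_subset hI i b)
      (sum_shiftDown_lt hI hi hlt) (sum_block_mem_F hI hq hc hci hi haI hia hab hb ?_))
    intro y hy hay
    by_contra hyb
    exact absurd (hmax y (Finset.mem_filter.2 ⟨hy, not_le.1 hyb⟩)) (not_le.2 hay)

end Blocks

/-- `m_{I,ℓ}` is `i - ℓ` for an element `i ≥ ℓ` of `I ∪ {n + 1}` with no element of `I`
in `[ℓ, i)`. -/
lemma exists_mIdx_eq {n : ℕ} {I : Finset ℕ} {l : ℕ} (hl : l ∈ Finset.Icc 1 n) :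
    ∃ i, (i ∈ I ∨ i = n + 1) ∧ l ≤ i ∧ i ≤ n + 1 ∧ (∀ y ∈ I, l ≤ y → i ≤ y) ∧
      mIdx n I l = i - l := by
  rw [Finset.mem_Icc] at hl
  have hmem : n + 1 ∈ {x : ℕ | (x = 0 ∨ x ∈ I ∨ x = n + 1) ∧ l ≤ x} :=
    ⟨Or.inr (Or.inr rfl), by omega⟩
  obtain ⟨h1, h2⟩ := Nat.sInf_mem ⟨_, hmem⟩
  exact ⟨_, h1.resolve_left (by omega), h2, Nat.sInf_le hmem,
    fun y hy hly => Nat.sInf_le ⟨Or.inr (Or.inl hy), hly⟩, rfl⟩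

/-- Theorem `thm.tl-FI`. For `I ⊆ [n]` and `ℓ ∈ [n]`:
`F(I) · (t_ℓ − m_{I,ℓ}) ⊆ F(< sum I)`. -/
theorem F_mul_t_sub_m_mem (n : ℕ) (k : Type*) [CommRing k]
    (I : Finset ℕ) (hI : I ⊆ Finset.Icc 1 n) (l : ℕ) (hl : l ∈ Finset.Icc 1 n)
    (q : MonoidAlgebra k (Equiv.Perm (Fin n))) (hq : q ∈ F n k I) :
    q * (t n k l - (mIdx n I l : MonoidAlgebra k (Equiv.Perm (Fin n)))) ∈
      Flt n k (I.sum id) := by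
  obtain ⟨i, hi, hli, hin, hmin, hm⟩ := exists_mIdx_eq (I := I) hl
  rw [Finset.mem_Icc] at hl
  have hinv : ∀ x, l ≤ x → x + 2 ≤ i →
      q * MonoidAlgebra.of k (Equiv.Perm (Fin n)) (sw n x) = q := by
    refine fun x h1 h2 => hq x (mem_nonShadow.2 ⟨by omega, by omega, fun hy => ?_, fun hy => ?_⟩)
    · have := hmin _ hy h1
      omega
    · have := hmin _ hy (by omega)
      omega
  have hlow : ∑ j ∈ Finset.Ico l i, q * MonoidAlgebra.of k (Equiv.Perm (Fin n)) (cyc n l j) =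
      q * (mIdx n I l : MonoidAlgebra k (Equiv.Perm (Fin n))) := by
    rw [Finset.sum_congr rfl fun j hj => ?_, Finset.sum_const, Nat.card_Ico, hm, nsmul_eq_mul,
      Nat.cast_comm]
    rw [Finset.mem_Ico] at hj
    exact mul_of_cyc_eq_self hj.1 fun x h1 h2 => hinv x h1 (by omega)
  have hIcc : Finset.Icc l n = Finset.Ico l (n + 1) := by
    ext y
    simp only [Finset.mem_Icc, Finset.mem_Ico]
    omega
  rw [mul_sub, t, Finset.mul_sum, hIcc, ← Finset.sum_Ico_consecutive _ hli hin, hlow,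
    add_sub_cancel_left]
  rcases hi with hi | rfl
  · obtain ⟨c, hlc, hc, hci⟩ : ∃ c, l ≤ c ∧ c ≤ i ∧ ((c = i ∧ c = l) ∨ c + 1 = i) := by
      rcases hli.eq_or_lt with rfl | hlt
      · exact ⟨l, le_rfl, le_rfl, Or.inl ⟨rfl, rfl⟩⟩
      · exact ⟨i - 1, by omega, by omega, by omega⟩
    have hstart : ∑ j ∈ Finset.Ico i (n + 1),
          q * MonoidAlgebra.of k (Equiv.Perm (Fin n)) (cyc n l j) =
        ∑ j ∈ Finset.Ico i (n + 1),
          q * MonoidAlgebra.of k (Equiv.Perm (Fin n)) (cyc n c j) := by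
      refine Finset.sum_congr rfl fun j hj => ?_
      rw [Finset.mem_Ico] at hj
      rw [← cyc_mul_cyc hlc (by omega : c ≤ j), map_mul, ← mul_assoc,
        mul_of_cyc_eq_self hlc fun x h1 h2 => hinv x h1 (by omega)]
    rw [hstart]
    exact sum_Ico_mem_Flt hI hq (by omega) (by omega) hi _ hin (Or.inr rfl)
  · simp

end OneSidedCycleShuffles
end
end

section
/- Let I and K be two subsets of [n−1] such that I is lacunar, K ≠ I, and K' ⊆ [n−1] \ I. Then sum I < sum K. -/
noncomputable section

namespace OneSidedCycleShuffles

/-- Lemma `lem.lac-sum-less2`. If `I, K ⊆ [n-1]`, `I` is lacunar, `K ≠ I`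
and `K' ⊆ [n-1] \ I`, then `sum I < sum K`. -/
theorem sum_lt_of_nonShadow_subset (n : ℕ) (I K : Finset ℕ)
    (hI : I ⊆ Finset.Icc 1 (n - 1)) (hK : K ⊆ Finset.Icc 1 (n - 1))
    (hlac : Lacunar I) (hne : K ≠ I)
    (hsub : nonShadow n K ⊆ Finset.Icc 1 (n - 1) \ I) :
    I.sum id < K.sum id := by
  have hcover : ∀ i ∈ I, i ∈ K ∨ i + 1 ∈ K := by
    intro i hi
    by_contra! hcon
    have hi1 := Finset.mem_Icc.mp (hI hi)
    have hmem : i ∈ nonShadow n K := by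
      simp only [nonShadow, Finset.mem_sdiff, Finset.mem_union, Finset.mem_image, not_or]
      refine ⟨hI hi, hcon.1, ?_⟩
      rintro ⟨k, hk, hki⟩
      obtain rfl : k = i + 1 := by omega
      exact hcon.2 hk
    exact (Finset.mem_sdiff.mp (hsub hmem)).2 hi
  by_cases hIK : I ⊆ K
  · obtain ⟨k, hk, hkI⟩ := Finset.exists_of_ssubset (hIK.ssubset_of_ne hne.symm)
    exact Finset.sum_lt_sum_of_subset hIK hk hkI (Finset.mem_Icc.mp (hK hk)).1
      fun _ _ _ => Nat.zero_le _
  · obtain ⟨j, hj, hjK⟩ := Finset.not_subset.mp hIK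
    let f : ℕ → ℕ := fun i => if i ∈ K then i else i + 1
    have hf_inj : Set.InjOn f I := by
      intro a ha b hb hab
      have h1 := hlac a ha
      have h2 := hlac b hb
      simp only [f] at hab
      grind
    have hf_image : I.image f ⊆ K := by
      intro k hk
      obtain ⟨i, hi, rfl⟩ := Finset.mem_image.mp hk
      have := hcover i hi
      simp only [f]
      grind
    calc I.sum id < ∑ i ∈ I, f i := by
          refine Finset.sum_lt_sum (fun i _ => ?_) ⟨j, hj, by simp [f, hjK]⟩
          simp only [f, id]
          split_ifs <;> omega
      _ = (I.image f).sum id := (Finset.sum_image (f := id) hf_inj).symm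
      _ ≤ K.sum id := Finset.sum_le_sum_of_subset hf_image

end OneSidedCycleShuffles
end
end

section
/- For every subset J of [n−1], there exists a unique lacunar subset I of [n−1] satisfying I' ⊆ J ⊆ [n−1] \ I. -/
noncomputable section

namespace OneSidedCycleShuffles

/-- Every finite set `K` of naturals has a subset consisting of those `i ∈ K` whose successor is
not selected. -/
lemma exists_mem_iff_succ_notMem (K : Finset ℕ) :
    ∃ I : Finset ℕ, ∀ i, i ∈ I ↔ i ∈ K ∧ i + 1 ∉ I := by
  induction K using Finset.induction_on_min with
  | empty => exact ⟨∅, by simp⟩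
  | insert a K ha ih =>
    obtain ⟨I, hI⟩ := ih
    have hlt : ∀ i ∈ I, a < i := fun i hi => ha i ((hI i).1 hi).1
    by_cases h : a + 1 ∈ I
    · refine ⟨I, fun i => ?_⟩
      grind
    · refine ⟨insert a I, fun i => ?_⟩
      grind

/-- A finite set in which membership of `i` is determined by membership of `i + 1` is unique. -/
lemma eq_of_mem_iff_succ_notMem {K I₁ I₂ : Finset ℕ}
    (h₁ : ∀ i, i ∈ I₁ ↔ i ∈ K ∧ i + 1 ∉ I₁) (h₂ : ∀ i, i ∈ I₂ ↔ i ∈ K ∧ i + 1 ∉ I₂) :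
    I₁ = I₂ := by
  by_contra hne
  obtain ⟨m, hm, hmax⟩ :=
    (symmDiff I₁ I₂).exists_max_image id (Finset.symmDiff_nonempty.2 hne)
  have hsucc : m + 1 ∉ symmDiff I₁ I₂ := fun h => by simpa using hmax _ h
  rw [Finset.mem_symmDiff] at hm hsucc
  grind

/-- The lacunar sets `I` with `I' ⊆ J ⊆ [n-1] \ I` are the solutions of a recursion on
membership. -/
lemma lacunar_interval_iff {n : ℕ} {J : Finset ℕ} (hJ : J ⊆ Finset.Icc 1 (n - 1))
    (I : Finset ℕ) :
    (I ⊆ Finset.Icc 1 (n - 1) ∧ Lacunar I ∧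
      nonShadow n I ⊆ J ∧ J ⊆ Finset.Icc 1 (n - 1) \ I) ↔
    ∀ i, i ∈ I ↔ i ∈ Finset.Icc 1 (n - 1) \ J ∧ i + 1 ∉ I := by
  have hshadow : ∀ i, i ∈ nonShadow n I ↔ i ∈ Finset.Icc 1 (n - 1) ∧ i ∉ I ∧ i + 1 ∉ I := by
    intro i
    simp only [nonShadow, Finset.mem_sdiff, Finset.mem_union, Finset.mem_image, not_or,
      not_exists, not_and, Finset.mem_Icc]
    refine and_congr_right fun hi => and_congr_right fun _ => ⟨fun h hI => h _ hI (by omega), ?_⟩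
    intro h x hx hxi
    exact h (by rwa [← hxi, Nat.sub_add_cancel (by omega)])
  simp only [Finset.subset_iff, hshadow, Lacunar, Finset.mem_sdiff] at hJ ⊢
  constructor
  · rintro ⟨hsub, hlac, hns, hdisj⟩ i
    grind
  · intro h
    refine ⟨?_, ?_, ?_, ?_⟩ <;> grind

/-- Corollary `cor.lac.bool`. For every `J ⊆ [n-1]` there is a unique
lacunar subset `I` of `[n-1]` with `I' ⊆ J ⊆ [n-1] \ I`. -/
theorem existsUnique_lacunar_interval (n : ℕ) (J : Finset ℕ) (hJ : J ⊆ Finset.Icc 1 (n - 1)) :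
    ∃! I : Finset ℕ, I ⊆ Finset.Icc 1 (n - 1) ∧ Lacunar I ∧
      nonShadow n I ⊆ J ∧ J ⊆ Finset.Icc 1 (n - 1) \ I := by
  obtain ⟨I, hI⟩ := exists_mem_iff_succ_notMem (Finset.Icc 1 (n - 1) \ J)
  simp only [lacunar_interval_iff hJ]
  exact ⟨I, hI, fun _ h => eq_of_mem_iff_succ_notMem h hI⟩

end OneSidedCycleShuffles
end
end

section
/- Let w ∈ S_n and let σ ∈ G(Des w). Then Inv((wσ)^{−1}) ⊆ Inv(w^{−1}), where for u ∈ S_n, Inv(u) := {(i,j) ∈ [n]×[n] : i < j and u(i) > u(j)} is the set of inversions of u. -/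
noncomputable section

namespace OneSidedCycleShuffles

/-- If `k ∉ T`, then every element of `G(T)` preserves the set `{1,…,k}`. -/
theorem val_lt_iff_of_mem_G {n : ℕ} {T : Finset ℕ} {k : ℕ} (hk : k ∉ T)
    {σ : Equiv.Perm (Fin n)} (hσ : σ ∈ G n T) (x : Fin n) :
    (σ x).val < k ↔ x.val < k := by
  induction hσ using Subgroup.closure_induction generalizing x with
  | mem τ hτ =>
    obtain ⟨i, hi, rfl⟩ := Finset.mem_image.mp (Finset.mem_coe.mp hτ)
    have hik : i ≠ k := fun h => hk (h ▸ hi)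
    unfold sw
    split_ifs with h
    · rw [Equiv.swap_apply_def]
      split_ifs with h₁ h₂
      · subst h₁; simp only; omega
      · subst h₂; simp only; omega
      · rfl
    · rfl
  | one => rfl
  | mul σ τ _ _ ihσ ihτ => rw [Equiv.Perm.mul_apply, ihσ, ihτ]
  | inv σ _ ih => rw [← ih (σ⁻¹ x), show σ (σ⁻¹ x) = x from σ.apply_symm_apply x]

/-- A permutation decreases along every interval consisting of descents. -/
theorem apply_lt_apply_of_forall_mem_Des {n : ℕ} {w : Equiv.Perm (Fin n)} {p q : Fin n}
    (hpq : p < q) (h : ∀ k, p.val < k → k ≤ q.val → k ∈ Des n w) : w q < w p := by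
  obtain ⟨q, hq⟩ := q
  induction q with
  | zero => exact absurd hpq (Nat.not_lt_zero _)
  | succ m ih =>
    have hstep : w ⟨m + 1, hq⟩ < w ⟨m, by omega⟩ := by
      have hdes := (Finset.mem_filter.mp (h (m + 1) hpq le_rfl)).2
      simpa [pval, hq, show m < n by omega] using hdes
    rcases (Nat.lt_succ_iff.mp hpq).lt_or_eq with hlt | heq
    · exact hstep.trans
        (ih (by omega) hlt fun k hk hkm => h k hk (hkm.trans (Nat.le_succ m)))
    · subst heq
      exact hstep

/-- Lemma `lem.aw.smaller.1`. For `w ∈ S_n` and `σ ∈ G(Des w)`: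
`Inv((wσ)⁻¹) ⊆ Inv(w⁻¹)`. -/
theorem inv_of_mul_descents_subset (n : ℕ) (w σ : Equiv.Perm (Fin n))
    (hσ : σ ∈ G n (Des n w)) :
    InvSet n (w * σ)⁻¹ ⊆ InvSet n w⁻¹ := by
  intro ⟨i, j⟩ hij
  simp only [InvSet, Finset.mem_filter, Finset.mem_product, Finset.mem_Icc] at hij ⊢
  obtain ⟨hmem, hlt, hinv⟩ := hij
  refine ⟨hmem, hlt, ?_⟩
  have hi : i - 1 < n := by omega
  have hj : j - 1 < n := by omega
  simp only [pval, hi, hj, dif_pos, mul_inv_rev, Equiv.Perm.mul_apply,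
    Nat.add_lt_add_iff_right] at hinv ⊢
  set p := w⁻¹ ⟨i - 1, hi⟩
  set q := w⁻¹ ⟨j - 1, hj⟩
  have hwp : w p = ⟨i - 1, hi⟩ := w.apply_symm_apply _
  have hwq : w q = ⟨j - 1, hj⟩ := w.apply_symm_apply _
  have hw : w p < w q := by
    rw [hwp, hwq, Fin.mk_lt_mk]
    omega
  by_contra hnot
  have hpq : p < q :=
    lt_of_le_of_ne (not_lt.mp hnot) fun h => hw.ne (congrArg w h)
  have hex : ∃ k, p.val < k ∧ k ≤ q.val ∧ k ∉ Des n w := by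
    by_contra! hall
    exact hw.not_gt (apply_lt_apply_of_forall_mem_Des hpq hall)
  obtain ⟨k, hpk, hkq, hk⟩ := hex
  have hσp := (val_lt_iff_of_mem_G hk (inv_mem hσ) p).mpr hpk
  have hσq := mt (val_lt_iff_of_mem_G hk (inv_mem hσ) q).mp (not_lt.mpr hkq)
  omega

end OneSidedCycleShuffles
end
end

section
/- Let w ∈ S_n, and let σ ∈ G(Des w) satisfy σ ≠ id. Then wσ < w with respect to the lexicographic order on S_n. -/
noncomputable section

namespace OneSidedCycleShuffles

/-- If `k ∉ T`, then every element of `G(T)` preserves the set `{1, …, k}` of the first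
`k` positions. -/
lemma apply_lt_iff_of_mem_G {n : ℕ} {T : Finset ℕ} {σ : Equiv.Perm (Fin n)}
    (hσ : σ ∈ G n T) {k : ℕ} (hk : k ∉ T) (x : Fin n) :
    (σ x).val < k ↔ x.val < k := by
  induction hσ using Subgroup.closure_induction generalizing x with
  | mem σ h =>
    obtain ⟨i, hi, rfl⟩ := Finset.mem_image.mp (Finset.mem_coe.mp h)
    have hik : i ≠ k := fun h => hk (h ▸ hi)
    unfold sw
    split_ifs with hin
    · rw [Equiv.swap_apply_def]
      split_ifs with h₁ h₂
      · subst h₁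
        simp only
        omega
      · subst h₂
        simp only
        omega
      · rfl
    · rfl
  | one => rfl
  | mul a b _ _ iha ihb => rw [Equiv.Perm.mul_apply, iha, ihb]
  | inv a _ ih => simpa using (ih (a⁻¹ x)).symm

/-- If all positions in `[a, b)` are descents of `w`, then `w(b) < w(a)`. -/
lemma pval_lt_pval_of_forall_mem_Des {n : ℕ} {w : Equiv.Perm (Fin n)} {a b : ℕ} (hab : a < b)
    (h : ∀ k, a ≤ k → k < b → k ∈ Des n w) : pval n w b < pval n w a := by
  induction b, hab using Nat.le_induction with
  | base => exact (Finset.mem_filter.mp (h a le_rfl (Nat.lt_succ_self a))).2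
  | succ b hab ih =>
    exact ((Finset.mem_filter.mp (h b (by omega) (Nat.lt_succ_self b))).2).trans
      (ih fun k h₁ h₂ => h k h₁ (by omega))

lemma pval_succ {n : ℕ} (w : Equiv.Perm (Fin n)) (x : Fin n) :
    pval n w (x.val + 1) = (w x).val + 1 := by
  simp [pval]

/-- A nonidentity permutation fixes everything below some point that it strictly increases. -/
lemma exists_lt_apply_of_ne_one {n : ℕ} {σ : Equiv.Perm (Fin n)} (hne : σ ≠ 1) :
    ∃ x, x < σ x ∧ ∀ y < x, σ y = y := by
  have hex : ∃ x, σ x ≠ x := by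
    by_contra! h
    exact hne (Equiv.ext h)
  obtain ⟨x, hx, hmin⟩ := WellFounded.has_min (wellFounded_lt (α := Fin n)) {x | σ x ≠ x} hex
  have hfix : ∀ y < x, σ y = y := fun y hy => by
    by_contra h
    exact hmin y h hy
  refine ⟨x, lt_of_not_ge fun hle => hx ?_, hfix⟩
  exact σ.injective (hfix _ (lt_of_le_of_ne hle hx))

/-- Proposition `prop.aw.smaller`. For `w ∈ S_n` and `σ ∈ G(Des w)` with
`σ ≠ id`, one has `wσ < w` in the lexicographic order on `S_n`. -/
theorem mul_descents_lexLT (n : ℕ) (w σ : Equiv.Perm (Fin n))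
    (hσ : σ ∈ G n (Des n w)) (hne : σ ≠ 1) :
    lexLT n (w * σ) w := by
  obtain ⟨x, hx, hfix⟩ := exists_lt_apply_of_ne_one hne
  refine ⟨x.val + 1, Finset.mem_Icc.mpr ⟨by omega, x.isLt⟩, ?_, fun j hj hjx => ?_⟩
  · rw [pval_succ, Equiv.Perm.mul_apply, ← pval_succ]
    refine pval_lt_pval_of_forall_mem_Des (Nat.succ_lt_succ hx) fun k hxk hkx => ?_
    by_contra hk
    have := (apply_lt_iff_of_mem_G hσ hk x).mpr hxk
    omega
  · obtain ⟨hj₁, hjn⟩ := Finset.mem_Icc.mp hj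
    obtain ⟨y, rfl⟩ : ∃ y : Fin n, j = y.val + 1 := ⟨⟨j - 1, by omega⟩, by simp only; omega⟩
    rw [pval_succ, pval_succ, Equiv.Perm.mul_apply, hfix y (Nat.lt_of_succ_lt_succ hjx)]

end OneSidedCycleShuffles
end
end

section
/- Let w ∈ S_n and i ∈ [f_{n+1}]. Then Qind(w) = i if and only if Q_i' ⊆ Des w ⊆ [n−1] \ Q_i. -/
noncomputable section

namespace OneSidedCycleShuffles

/-- Every finite set `E` has a lacunar subset `J` with `E ⊆ J ∪ (J - 1)`. -/
theorem exists_lacunar_subset (E : Finset ℕ) :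
    ∃ J ⊆ E, Lacunar J ∧ ∀ a ∈ E, a ∈ J ∨ a + 1 ∈ J := by
  induction E using Finset.induction_on_min with
  | empty => exact ⟨∅, by simp [Lacunar]⟩
  | insert a E ha ih =>
    obtain ⟨J, hJE, hlac, hJ⟩ := ih
    by_cases h : a + 1 ∈ J
    · exact ⟨J, hJE.trans (Finset.subset_insert a E), hlac, by grind⟩
    · refine ⟨insert a J, Finset.insert_subset_insert a hJE, ?_, by grind⟩
      intro b hb hb'
      rw [Finset.mem_insert] at hb hb'
      rcases hb with rfl | hb
      · rcases hb' with hb' | hb'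
        · omega
        · exact h hb'
      · rcases hb' with hb' | hb'
        · have := ha b (hJE hb)
          omega
        · exact hlac b hb hb'

/-- If `J` is lacunar and `J ⊆ K ∪ (K - 1)`, then `sum J < sum K` unless `J = K`. -/
theorem eq_of_sum_le {J K : Finset ℕ} (hJ : Lacunar J) (hK : ∀ k ∈ K, 1 ≤ k)
    (hJK : ∀ j ∈ J, j ∈ K ∨ j + 1 ∈ K) (hsum : K.sum id ≤ J.sum id) : J = K := by
  let f : ℕ → ℕ := fun j => if j ∈ K then j else j + 1
  have hle : ∀ j, j ≤ f j := fun j => by grind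
  have hinj : Set.InjOn f J := by
    intro x hx y hy hxy
    have := hJ x hx
    have := hJ y hy
    grind
  have himage : J.image f ⊆ K := by
    intro k hk
    obtain ⟨j, hj, rfl⟩ := Finset.mem_image.mp hk
    grind
  have hsum_image : (J.image f).sum id = J.sum f := Finset.sum_image hinj
  have hsum_le : J.sum id ≤ J.sum f := Finset.sum_le_sum fun j _ => hle j
  have hsum_subset : (J.image f).sum id ≤ K.sum id := Finset.sum_le_sum_of_subset himage
  have hsum_eq : J.sum id = J.sum f := by omega
  have hfix : ∀ j ∈ J, id j = f j :=
    (Finset.sum_eq_sum_iff_of_le fun j _ => hle j).mp hsum_eq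
  have himage_eq : J.image f = J := by
    rw [← Finset.image_congr (f := id) (g := f) fun j hj => hfix j hj, Finset.image_id]
  rw [himage_eq] at himage hsum_subset
  refine himage.antisymm fun k hk => ?_
  by_contra hkJ
  have hlt : J.sum id < K.sum id :=
    Finset.sum_lt_sum_of_subset himage hk hkJ (hK k hk) fun _ _ _ => Nat.zero_le _
  omega

/-- For `I ⊆ [n-1]`, the inclusion `I' ⊆ D` says that every element of `[n-1] \ D`
lies in the shadow of `I`. -/
theorem nonShadow_subset_iff {n : ℕ} {I D : Finset ℕ} (hI : I ⊆ Finset.Icc 1 (n - 1)) :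
    nonShadow n I ⊆ D ↔ ∀ a ∈ Finset.Icc 1 (n - 1) \ D, a ∈ I ∨ a + 1 ∈ I := by
  have himage : ∀ a ∈ Finset.Icc 1 (n - 1), a ∈ I.image (fun i => i - 1) ↔ a + 1 ∈ I := by
    intro a ha
    rw [Finset.mem_image]
    constructor
    · rintro ⟨b, hb, rfl⟩
      have := Finset.mem_Icc.mp (hI hb)
      rwa [Nat.sub_add_cancel this.1]
    · exact fun h => ⟨a + 1, h, rfl⟩
  simp only [nonShadow, Finset.subset_iff, Finset.mem_sdiff, Finset.mem_union]
  constructor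
  · rintro h a ⟨ha, haD⟩
    by_contra hc
    exact haD (h ⟨ha, by rwa [himage a ha]⟩)
  · rintro h a ⟨ha, hc⟩
    by_contra haD
    rw [himage a ha] at hc
    exact hc (h a ⟨ha, haD⟩)

/-- Proposition `prop.Qind.equivalent`. For `w ∈ S_n` and
`i ∈ [f_{n+1}]`: `Qind w = i` iff `Q_i' ⊆ Des w ⊆ [n-1] \ Q_i`. -/
theorem Qind_eq_iff (n : ℕ)
    (Q : ℕ → Finset ℕ)
    (hQlac : ∀ i ∈ Finset.Icc 1 (Nat.fib (n + 1)),
      Q i ⊆ Finset.Icc 1 (n - 1) ∧ Lacunar (Q i))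
    (hQbij : ∀ J : Finset ℕ, J ⊆ Finset.Icc 1 (n - 1) → Lacunar J →
      ∃! i, i ∈ Finset.Icc 1 (Nat.fib (n + 1)) ∧ Q i = J)
    (hQmono : ∀ i ∈ Finset.Icc 1 (Nat.fib (n + 1)), ∀ j ∈ Finset.Icc 1 (Nat.fib (n + 1)),
      i ≤ j → (Q i).sum id ≤ (Q j).sum id)
    (w : Equiv.Perm (Fin n)) (i : ℕ) (hi : i ∈ Finset.Icc 1 (Nat.fib (n + 1))) :
    Qind n Q w = i ↔
      (nonShadow n (Q i) ⊆ Des n w ∧ Des n w ⊆ Finset.Icc 1 (n - 1) \ Q i) := by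
  have hDes : Des n w ⊆ Finset.Icc 1 (n - 1) := Finset.filter_subset _ _
  have hQind : ∀ j ∈ Finset.Icc 1 (Nat.fib (n + 1)), nonShadow n (Q j) ⊆ Des n w →
      Des n w ⊆ Finset.Icc 1 (n - 1) \ Q j → Qind n Q w = j := by
    intro j hj hsub hdisj
    refine IsLeast.csInf_eq
      ⟨⟨(Finset.mem_Icc.mp hj).1, (Finset.mem_Icc.mp hj).2, hsub⟩, ?_⟩
    rintro k ⟨hk1, hk2, hk⟩
    have hkmem := Finset.mem_Icc.mpr ⟨hk1, hk2⟩
    by_contra! hlt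
    have hQeq : Q j = Q k := by
      refine eq_of_sum_le (hQlac j hj).2
        (fun a ha => (Finset.mem_Icc.mp ((hQlac k hkmem).1 ha)).1) (fun a ha => ?_)
        (hQmono k hkmem j hj hlt.le)
      refine (nonShadow_subset_iff (hQlac k hkmem).1).mp hk a
        (Finset.mem_sdiff.mpr ⟨(hQlac j hj).1 ha, fun haD => ?_⟩)
      exact (Finset.mem_sdiff.mp (hdisj haD)).2 ha
    have := (hQbij (Q j) (hQlac j hj).1 (hQlac j hj).2).unique
      ⟨hj, rfl⟩ ⟨hkmem, hQeq.symm⟩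
    omega
  refine ⟨fun h => ?_, fun h => hQind i hi h.1 h.2⟩
  obtain ⟨J, hJE, hlac, hJ⟩ := exists_lacunar_subset (Finset.Icc 1 (n - 1) \ Des n w)
  have hJI := hJE.trans Finset.sdiff_subset
  obtain ⟨j, ⟨hj, rfl⟩, -⟩ := hQbij J hJI hlac
  have hsub := (nonShadow_subset_iff hJI).mpr hJ
  have hdisj : Des n w ⊆ Finset.Icc 1 (n - 1) \ Q j := fun a ha =>
    Finset.mem_sdiff.mpr ⟨hDes ha, fun haJ => (Finset.mem_sdiff.mp (hJE haJ)).2 ha⟩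
  obtain rfl : j = i := (hQind j hj hsub hdisj).symm.trans h
  exact ⟨hsub, hdisj⟩

end OneSidedCycleShuffles
end
end

section
/- For each i ∈ [f_{n+1}], there exists a permutation w ∈ S_n satisfying Qind(w) = i. -/
noncomputable section

namespace OneSidedCycleShuffles

/-- If a set `J` of positive integers contains `i` or `i + 1` for each `i` in a lacunar set `I`,
and its sum does not exceed that of `I`, then `J = I`. -/
theorem eq_of_shift_mem_of_sum_le {I J : Finset ℕ} (hI : Lacunar I) (hJ : ∀ j ∈ J, 1 ≤ j)
    (h : ∀ i ∈ I, i ∈ J ∨ i + 1 ∈ J) (hs : J.sum id ≤ I.sum id) : J = I := by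
  set φ : ℕ → ℕ := fun i => if i ∈ J then i else i + 1 with hφ
  have hle : ∀ i ∈ I, id i ≤ φ i := by
    intro i _
    simp only [hφ, id]
    split_ifs <;> omega
  have hinj : Set.InjOn φ I := by
    intro a ha b hb hab
    have h₁ := hI a ha
    have h₂ := hI b hb
    simp only [hφ] at hab
    split_ifs at hab
    · exact hab
    · exact absurd (hab ▸ ha) h₂
    · exact absurd (hab ▸ hb) h₁
    · omega
  have himage : I.image φ ⊆ J := by
    intro x hx
    obtain ⟨i, hi, rfl⟩ := Finset.mem_image.1 hx
    have := h i hi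
    simp only [hφ]
    split_ifs <;> tauto
  have hφJ : ∑ i ∈ I, φ i ≤ J.sum id := by
    have := Finset.sum_le_sum_of_subset (f := id) himage
    rwa [Finset.sum_image hinj] at this
  have hφI := (Finset.sum_eq_sum_iff_of_le hle).1
    (le_antisymm (Finset.sum_le_sum hle) (hφJ.trans hs))
  have hIJ : I ⊆ J := by
    intro i hi
    by_contra hiJ
    have := hφI i hi
    simp [hφ, hiJ] at this
  refine (hIJ.antisymm fun j hj => ?_).symm
  by_contra hjI
  have hlt : I.sum id < J.sum id :=
    Finset.sum_lt_sum_of_subset hIJ hj hjI (hJ j hj) fun _ _ _ => Nat.zero_le _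
  omega

/-- Every subset of `[n-1]` is the descent set of a permutation in `S_n`. -/
theorem exists_Des_eq (n : ℕ) {D : Finset ℕ} (hD : D ⊆ Finset.Icc 1 (n - 1)) :
    ∃ w : Equiv.Perm (Fin n), Des n w = D := by
  let c : ℕ → ℕ := fun a => ((Finset.Icc 1 a).filter (· ∉ D)).card
  let f : Fin n → ℕ ×ₗ (Fin n)ᵒᵈ := fun a => toLex (c a, OrderDual.toDual a)
  have hf : Function.Injective f := by
    intro a b hab
    exact congrArg (fun p => OrderDual.ofDual (ofLex p).2) hab
  have hmono : StrictMono (f ∘ Tuple.sort f) :=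
    (Tuple.monotone_sort f).strictMono_of_injective (hf.comp (Tuple.sort f).injective)
  have hlt : ∀ a b, (Tuple.sort f)⁻¹ a < (Tuple.sort f)⁻¹ b ↔ f a < f b := by
    intro a b
    rw [← hmono.lt_iff_lt]
    simp
  refine ⟨(Tuple.sort f)⁻¹, ?_⟩
  ext i
  by_cases hi : i ∈ Finset.Icc 1 (n - 1)
  swap
  · simp only [Des, Finset.mem_filter, hi, false_and, false_iff]
    exact fun h => hi (hD h)
  obtain ⟨h₁, h₂⟩ := Finset.mem_Icc.1 hi
  obtain ⟨a, rfl⟩ : ∃ a, i = a + 1 := ⟨i - 1, by omega⟩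
  have ha : a < n := by omega
  have ha' : a + 1 < n := by omega
  have hc : c (a + 1) = c a + if a + 1 ∈ D then 0 else 1 := by
    simp only [c]
    rw [← Finset.insert_Icc_right_eq_Icc_add_one (by omega), Finset.filter_insert]
    split_ifs with h <;> simp
  have key : (Tuple.sort f)⁻¹ ⟨a + 1, ha'⟩ < (Tuple.sort f)⁻¹ ⟨a, ha⟩ ↔ a + 1 ∈ D := by
    rw [hlt, Prod.Lex.toLex_lt_toLex]
    simp only [hc, OrderDual.toDual_lt_toDual, Fin.mk_lt_mk]
    split_ifs with h <;> simp [h]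
  simp only [Des, Finset.mem_filter, hi, true_and, pval, Nat.add_sub_cancel, ha, ha', dif_pos]
  rw [← key, Fin.lt_def]
  omega

/-- Among lacunar subsets of `[n-1]`, inclusion of non-shadows forces equality unless the sum
strictly increases. -/
theorem eq_of_nonShadow_subset {n : ℕ} {I J : Finset ℕ} (hI : I ⊆ Finset.Icc 1 (n - 1))
    (hJ : J ⊆ Finset.Icc 1 (n - 1)) (hlac : Lacunar I) (h : nonShadow n J ⊆ nonShadow n I)
    (hs : J.sum id ≤ I.sum id) : J = I := by
  refine eq_of_shift_mem_of_sum_le hlac (fun j hj => (Finset.mem_Icc.1 (hJ hj)).1) ?_ hs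
  intro i hi
  by_contra! hc
  have hi₁ := (Finset.mem_Icc.1 (hI hi)).1
  have hmem : i ∈ nonShadow n J := by
    simp only [nonShadow, Finset.mem_sdiff, Finset.mem_union, Finset.mem_image, not_or, not_exists,
      not_and]
    refine ⟨hI hi, hc.1, fun j hj hji => hc.2 ?_⟩
    rwa [show i + 1 = j by omega]
  have := h hmem
  simp [nonShadow, hi] at this

/-- Lemma `lem.Qind.surj`. For each `i ∈ [f_{n+1}]` there exists a
permutation `w ∈ S_n` with `Qind w = i`. -/
theorem Qind_surjective (n : ℕ)
    (Q : ℕ → Finset ℕ)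
    (hQlac : ∀ i ∈ Finset.Icc 1 (Nat.fib (n + 1)),
      Q i ⊆ Finset.Icc 1 (n - 1) ∧ Lacunar (Q i))
    (hQbij : ∀ J : Finset ℕ, J ⊆ Finset.Icc 1 (n - 1) → Lacunar J →
      ∃! i, i ∈ Finset.Icc 1 (Nat.fib (n + 1)) ∧ Q i = J)
    (hQmono : ∀ i ∈ Finset.Icc 1 (Nat.fib (n + 1)), ∀ j ∈ Finset.Icc 1 (Nat.fib (n + 1)),
      i ≤ j → (Q i).sum id ≤ (Q j).sum id)
    (i : ℕ) (hi : i ∈ Finset.Icc 1 (Nat.fib (n + 1))) :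
    ∃ w : Equiv.Perm (Fin n), Qind n Q w = i := by
  obtain ⟨w, hw⟩ := exists_Des_eq n (D := nonShadow n (Q i)) Finset.sdiff_subset
  refine ⟨w, IsLeast.csInf_eq ⟨?_, ?_⟩⟩
  · exact ⟨(Finset.mem_Icc.1 hi).1, (Finset.mem_Icc.1 hi).2, hw.ge⟩
  · rintro j ⟨hj₁, hj₂, hj⟩
    by_contra! hlt
    have hjm := Finset.mem_Icc.2 ⟨hj₁, hj₂⟩
    have hJI : Q j = Q i := eq_of_nonShadow_subset (hQlac i hi).1 (hQlac j hjm).1 (hQlac i hi).2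
      (hw ▸ hj) (hQmono j hjm i hi hlt.le)
    have := (hQbij (Q i) (hQlac i hi).1 (hQlac i hi).2).unique ⟨hjm, hJI⟩ ⟨hi, rfl⟩
    omega

end OneSidedCycleShuffles
end
end
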